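/- arXiv:1010.2767 — 2 statements merged into one kernel-verified Lean document; each statement's English description precedes it below -/
import Mathlib

section
/- Let M be a Gotzmann set of monomials of degree t in S, and for 0 ≤ i ≤ t set d_i = |M^i| (with d_{−1} = 0). Then for every 0 ≤ i ≤ t+1, |(S_1·M)^i| = max{ d_i^{<n−2>}, d_{i−1} }. -/
open scoped Classical
open Finset

noncomputable section

/-- The monomials of degree `t` in `n` variables, identified with exponent vectors. -/
def degMon (n t : ℕ) : Finset (Fin n → ℕ) := Finset.Nat.antidiagonalTuple n t

/-- The exponent of `x_1` in a monomial. -/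
def x1exp {n : ℕ} (m : Fin n → ℕ) : ℕ := if h : 0 < n then m ⟨0, h⟩ else 0

/-- `lexLt u v` : `u` is lexicographically smaller than `v` as monomials
(with `x_1 > x_2 > ... > x_n`), i.e. `v > u`. -/
def lexLt {n : ℕ} (u v : Fin n → ℕ) : Prop :=
  ∃ i : Fin n, (∀ j : Fin n, j < i → u j = v j) ∧ u i < v i

/-- `M` is a lexsegment set inside the ground set `G` of monomials. -/
def IsLexSeg {n : ℕ} (G M : Finset (Fin n → ℕ)) : Prop :=
  M ⊆ G ∧ ∀ m ∈ M, ∀ v ∈ G, lexLt m v → v ∈ M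

/-- The lexsegment set consisting of the top `d` monomials of `G` in the lex order. -/
def lexSeg {n : ℕ} (G : Finset (Fin n → ℕ)) (d : ℕ) : Finset (Fin n → ℕ) :=
  G.filter (fun m => (G.filter (fun v => m = v ∨ lexLt m v)).card ≤ d)

/-- `S_1 · M` : all monomials `u * m` with `u` a variable and `m ∈ M`. -/
def S1mul (n : ℕ) (M : Finset (Fin n → ℕ)) : Finset (Fin n → ℕ) :=
  Finset.univ.biUnion (fun i : Fin n => M.image (fun m => m + Pi.single i 1))

/-- `S'_1 · M` : all monomials `x_i * m` with `2 ≤ i ≤ n` and `m ∈ M`. -/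
def S1'mul (n : ℕ) (M : Finset (Fin n → ℕ)) : Finset (Fin n → ℕ) :=
  (Finset.univ.filter (fun i : Fin n => (i : ℕ) ≠ 0)).biUnion
    (fun i => M.image (fun m => m + Pi.single i 1))

/-- `d^{<k>}` : the number of monomials obtained by multiplying each member of the
lexsegment set of `d` monomials of a fixed degree in `k+1` variables by each of the
`k+1` variables.  (We realize it in degree `d`, where the lexsegment set exists;
the number is independent of the chosen degree.  Also `0^{<k>} = 0`.) -/
def growth (d k : ℕ) : ℕ := (S1mul (k + 1) (lexSeg (degMon (k + 1) d) d)).card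

/-- The monomials of `R_t` where `R = S/(x_1^a)` : degree-`t` monomials whose
`x_1`-exponent is at most `a - 1`. -/
def RMon (n a t : ℕ) : Finset (Fin n → ℕ) :=
  (degMon n t).filter (fun m => x1exp m < a)

/-- `R_1 · M` : the monomials of `S_1 · M` not divisible by `x_1^a`. -/
def R1mul (n a : ℕ) (M : Finset (Fin n → ℕ)) : Finset (Fin n → ℕ) :=
  (S1mul n M).filter (fun m => x1exp m < a)

/-- `d_{n,t}` : the size of `R_1 · L` for the lexsegment set `L` of `d` monomials in `R_t`. -/
def dnt (n a t d : ℕ) : ℕ := (R1mul n a (lexSeg (RMon n a t) d)).card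

/-- `M^i` : the monomials of `M` divisible by `x_1^i` but not by `x_1^{i+1}`. -/
def comp {n : ℕ} (M : Finset (Fin n → ℕ)) (i : ℕ) : Finset (Fin n → ℕ) :=
  M.filter (fun m => x1exp m = i)

/-- `I(M)` : the smallest `i` such that `M^i ≠ ∅`. -/
def Imon {n : ℕ} (M : Finset (Fin n → ℕ)) : ℕ := sInf {i | (comp M i).Nonempty}

/-- `M` is Gotzmann in `S_t`. -/
def GotzmannS (n t : ℕ) (M : Finset (Fin n → ℕ)) : Prop :=
  (S1mul n (lexSeg (degMon n t) M.card)).card = (S1mul n M).card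

/-- `M` is Gotzmann in `R_t`, `R = S/(x_1^a)`. -/
def GotzmannR (n a t : ℕ) (M : Finset (Fin n → ℕ)) : Prop :=
  (R1mul n a (lexSeg (RMon n a t) M.card)).card = (R1mul n a M).card

/-- The monomials of degree `t` of `S' = F[x_2,...,x_n]`, viewed inside the `n`
variables as the monomials with `x_1`-exponent `0`. -/
def SpMon (n t : ℕ) : Finset (Fin n → ℕ) :=
  (degMon n t).filter (fun m => x1exp m = 0)

/-- `M` is Gotzmann in `S' = F[x_2,...,x_n]` (in degree `t`). -/
def GotzmannSp (n t : ℕ) (M : Finset (Fin n → ℕ)) : Prop :=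
  (S1'mul n (lexSeg (SpMon n t) M.card)).card = (S1'mul n M).card

/-- Dividing a monomial by the pure power of `x_1` it contains: set the first exponent to `0`. -/
def clearX1 {n : ℕ} (m : Fin n → ℕ) : Fin n → ℕ :=
  fun j => if (j : ℕ) = 0 then 0 else m j

/-- `M^i / x_1` : the monomials `m` of `S'` with `m * x_1^i ∈ M^i` (applied to `M = M^i`). -/
def divX1 {n : ℕ} (M : Finset (Fin n → ℕ)) : Finset (Fin n → ℕ) :=
  M.image clearX1

/-- `u · M` : the monomials `u * m` with `m ∈ M`. -/
def mulMon {n : ℕ} (u : Fin n → ℕ) (M : Finset (Fin n → ℕ)) : Finset (Fin n → ℕ) :=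
  M.image (fun m => u + m)

/-- The set `B` of degree-`t` monomials of `S` divisible by `x_1^a`. -/
def Bset (n a t : ℕ) : Finset (Fin n → ℕ) :=
  (degMon n t).filter (fun m => a ≤ x1exp m)

theorem mem_degMon {n t : ℕ} {m : Fin n → ℕ} : m ∈ degMon n t ↔ ∑ i, m i = t := by
  simp [degMon, Finset.Nat.mem_antidiagonalTuple]

theorem mem_S1mul {n : ℕ} {M : Finset (Fin n → ℕ)} {v : Fin n → ℕ} :
    v ∈ S1mul n M ↔ ∃ i, ∃ m ∈ M, m + Pi.single i 1 = v := by
  simp [S1mul]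

theorem sum_add_single {n : ℕ} (m : Fin n → ℕ) (i : Fin n) :
    ∑ j, (m + Pi.single i 1 : Fin n → ℕ) j = ∑ j, m j + 1 := by
  simp [Finset.sum_add_distrib]

theorem S1mul_sub {n t : ℕ} {M : Finset (Fin n → ℕ)} (hM : M ⊆ degMon n t) :
    S1mul n M ⊆ degMon n (t+1) := by
  intro v hv
  obtain ⟨i, m, hm, rfl⟩ := mem_S1mul.1 hv
  rw [mem_degMon, sum_add_single, mem_degMon.1 (hM hm)]

theorem S1mul_mono {n : ℕ} {M N : Finset (Fin n → ℕ)} (h : M ⊆ N) : S1mul n M ⊆ S1mul n N := by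
  intro v hv
  obtain ⟨i, m, hm, rfl⟩ := mem_S1mul.1 hv
  exact mem_S1mul.2 ⟨i, m, h hm, rfl⟩

theorem lexLt_iff {n : ℕ} {u v : Fin n → ℕ} : lexLt u v ↔ toLex u < toLex v := Iff.rfl

theorem lexLt_tri {n : ℕ} (u v : Fin n → ℕ) : lexLt u v ∨ u = v ∨ lexLt v u := by
  rcases lt_trichotomy (toLex u) (toLex v) with h | h | h
  · exact Or.inl h
  · exact Or.inr (Or.inl h)
  · exact Or.inr (Or.inr h)

theorem lexLt_trans {n : ℕ} {u v w : Fin n → ℕ} (h : lexLt u v) (h' : lexLt v w) : lexLt u w :=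
  lt_trans (lexLt_iff.1 h) (lexLt_iff.1 h')

theorem lexLt_irr {n : ℕ} {u : Fin n → ℕ} (h : lexLt u u) : False :=
  lt_irrefl _ (lexLt_iff.1 h)

theorem lexSeg_sub_of {n : ℕ} {G A B : Finset (Fin n → ℕ)} (hA : IsLexSeg G A)
    (hB : IsLexSeg G B) (h : A.card ≤ B.card) : A ⊆ B := by
  intro a ha
  by_contra hab
  have : B ⊂ A := by
    refine Finset.ssubset_iff_subset_ne.2 ⟨?_, fun h => hab (h ▸ ha)⟩
    intro b hb
    rcases lexLt_tri a b with h1 | h1 | h1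
    · exact hA.2 a ha b (hB.1 hb) h1
    · exact h1 ▸ ha
    · exact absurd (hB.2 b hb a (hA.1 ha) h1) hab
  have := Finset.card_lt_card this
  omega

theorem card_union_lexSeg {n : ℕ} {G A B : Finset (Fin n → ℕ)} (hA : IsLexSeg G A)
    (hB : IsLexSeg G B) : (A ∪ B).card = max A.card B.card := by
  rcases le_total A.card B.card with h | h
  · rw [Finset.union_eq_right.2 (lexSeg_sub_of hA hB h), max_eq_right h]
  · rw [Finset.union_eq_left.2 (lexSeg_sub_of hB hA h), max_eq_left h]

theorem exists_lexSeg {n : ℕ} (G : Finset (Fin n → ℕ)) (d : ℕ) (hd : d ≤ G.card) :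
    ∃ L, IsLexSeg G L ∧ L.card = d := by
  induction d with
  | zero => exact ⟨∅, ⟨by simp, by simp⟩, rfl⟩
  | succ d ih =>
    obtain ⟨L, hL, hc⟩ := ih (by omega)
    have hne : (G \ L).Nonempty := by
      rw [← Finset.card_pos, Finset.card_sdiff_of_subset hL.1]; omega
    obtain ⟨x, hx, hmax⟩ := Finset.exists_max_image (G \ L) (fun m => toLex m) hne
    rw [Finset.mem_sdiff] at hx
    refine ⟨insert x L, ⟨?_, ?_⟩, ?_⟩
    · exact Finset.insert_subset hx.1 hL.1
    · intro m hm v hv hlt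
      by_cases hvL : v ∈ L
      · exact Finset.mem_insert_of_mem hvL
      · rcases Finset.mem_insert.1 hm with rfl | hm
        · exact absurd (hmax v (Finset.mem_sdiff.2 ⟨hv, hvL⟩)) (not_le.2 hlt)
        · exact absurd (hL.2 m hm v hv hlt) hvL
    · rw [Finset.card_insert_of_notMem hx.2, hc]

theorem lexSeg_eq {n : ℕ} {G L : Finset (Fin n → ℕ)} (hL : IsLexSeg G L) :
    lexSeg G L.card = L := by
  ext m
  simp only [lexSeg, Finset.mem_filter]
  constructor
  · rintro ⟨hm, hc⟩
    by_contra hmL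
    have : insert m L ⊆ G.filter (fun v => m = v ∨ lexLt m v) := by
      intro v hv
      rcases Finset.mem_insert.1 hv with rfl | hv
      · simp [hm]
      · refine Finset.mem_filter.2 ⟨hL.1 hv, ?_⟩
        rcases lexLt_tri m v with h | h | h
        · exact Or.inr h
        · exact Or.inl h
        · exact absurd (hL.2 v hv m hm h) hmL
    have := Finset.card_le_card this
    rw [Finset.card_insert_of_notMem hmL] at this
    omega
  · intro hm
    refine ⟨hL.1 hm, Finset.card_le_card ?_⟩
    intro v hv
    rw [Finset.mem_filter] at hv
    rcases hv.2 with rfl | h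
    · exact hm
    · exact hL.2 m hm v hv.1 h

theorem lexSeg_spec {n : ℕ} {G : Finset (Fin n → ℕ)} {d : ℕ} (hd : d ≤ G.card) :
    IsLexSeg G (lexSeg G d) ∧ (lexSeg G d).card = d := by
  obtain ⟨L, hL, rfl⟩ := exists_lexSeg G d hd
  rw [lexSeg_eq hL]
  exact ⟨hL, rfl⟩

theorem add_single_of_pos {n : ℕ} (v : Fin n → ℕ) (j : Fin n) (h : 0 < v j) :
    ∃ v' : Fin n → ℕ, v = v' + Pi.single j 1 := by
  refine ⟨Function.update v j (v j - 1), ?_⟩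
  funext k
  by_cases hk : k = j
  · subst hk; simp; omega
  · simp [hk]

theorem le_lex_absurd {n : ℕ} {u v : Fin n → ℕ} (hs : ∑ i, u i = ∑ i, v i) (q : Fin n)
    (h : ∀ k, u k ≤ v k) (hq : u q < v q) : False := by
  have := Finset.sum_lt_sum (s := Finset.univ) (f := u) (g := v) (fun i _ => h i) ⟨q, by simp, hq⟩
  omega

theorem S1mul_lex {n t : ℕ} {L : Finset (Fin n → ℕ)} (hL : IsLexSeg (degMon n t) L) :
    IsLexSeg (degMon n (t+1)) (S1mul n L) := by
  refine ⟨S1mul_sub hL.1, ?_⟩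
  intro w hw v hv hlt
  obtain ⟨i, m, hm, rfl⟩ := mem_S1mul.1 hw
  have hsv := mem_degMon.1 hv
  have hsm := mem_degMon.1 (hL.1 hm)
  have hne : (Finset.univ.filter (fun j => 0 < v j)).Nonempty := by
    by_contra hcon
    rw [Finset.not_nonempty_iff_eq_empty, Finset.filter_eq_empty_iff] at hcon
    have : ∑ j, v j = 0 := Finset.sum_eq_zero (fun j _ => by have := hcon (Finset.mem_univ j); omega)
    omega
  obtain ⟨j, hj, hjmax⟩ := Finset.exists_max_image _ (fun j => j) hne
  simp only [Finset.mem_filter, Finset.mem_univ, true_and] at hj hjmax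
  obtain ⟨v', rfl⟩ := add_single_of_pos v j hj
  rw [sum_add_single] at hsv
  have hz : ∀ k, j < k → v' k = 0 := by
    intro k hk
    by_contra h
    have := hjmax k (by simp; omega)
    exact absurd this (not_le.2 hk)
  refine mem_S1mul.2 ⟨j, v', ?_, rfl⟩
  rcases lexLt_tri m v' with h | h | h
  · exact hL.2 m hm v' (mem_degMon.2 (by omega)) h
  · exact h ▸ hm
  · exfalso
    obtain ⟨q, hq1, hq2⟩ := h
    by_cases hqj : q < j
    · obtain ⟨p, hp1, hp2⟩ := hlt
      rcases lt_or_ge q p with hqp | hqp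
      · have := hp1 q hqp
        simp [Pi.single_eq_of_ne hqj.ne] at this
        omega
      · have hpj : p ≠ j := (lt_of_le_of_lt hqp hqj).ne
        simp [Pi.single_eq_of_ne hpj] at hp2
        rcases eq_or_lt_of_le hqp with rfl | hlt
        · omega
        · have := hq1 p hlt; omega
    · refine le_lex_absurd (u := v') (v := m) (by omega) q ?_ hq2
      intro k
      rcases lt_trichotomy k q with h | h | h
      · exact (hq1 k h).le
      · subst h; exact hq2.le
      · rw [hz k (lt_of_le_of_lt (not_lt.1 hqj) h)]; exact Nat.zero_le _

/-- slices -/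
def sl {n : ℕ} (k : Fin (n+1)) (a : ℕ) (M : Finset (Fin (n+1) → ℕ)) : Finset (Fin n → ℕ) :=
  (M.filter (fun m => m k = a)).image k.removeNth

theorem mem_sl {n : ℕ} {k : Fin (n+1)} {a : ℕ} {M : Finset (Fin (n+1) → ℕ)} {u : Fin n → ℕ} :
    u ∈ sl k a M ↔ (k.insertNth a u : Fin (n+1) → ℕ) ∈ M := by
  simp only [sl, Finset.mem_image, Finset.mem_filter]
  constructor
  · rintro ⟨m, ⟨hm, rfl⟩, rfl⟩
    simpa using hm
  · intro h
    exact ⟨_, ⟨h, by simp⟩, by simp⟩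

theorem card_sl {n : ℕ} (k : Fin (n+1)) (a : ℕ) (M : Finset (Fin (n+1) → ℕ)) :
    (sl k a M).card = (M.filter (fun m => m k = a)).card := by
  refine Finset.card_image_of_injOn ?_
  intro x hx y hy hxy
  simp only [Finset.coe_filter, Set.mem_ofPred_eq] at hx hy
  rw [← Fin.insertNth_self_removeNth k x, ← Fin.insertNth_self_removeNth k y, hxy, hx.2, hy.2]

theorem sum_insertNth {n : ℕ} (k : Fin (n+1)) (a : ℕ) (u : Fin n → ℕ) :
    ∑ j, (k.insertNth a u : Fin (n+1) → ℕ) j = a + ∑ j, u j := by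
  rw [Fin.sum_univ_succAbove _ k]; simp

theorem lexLt_insertNth {n : ℕ} (k : Fin (n+1)) (a : ℕ) (u v : Fin n → ℕ) :
    lexLt (k.insertNth a u : Fin (n+1) → ℕ) (k.insertNth a v) ↔ lexLt u v := by
  constructor
  · rintro ⟨i, h1, h2⟩
    rcases Fin.eq_self_or_eq_succAbove k i with rfl | ⟨i', rfl⟩
    · simp at h2
    · refine ⟨i', fun j hj => ?_, by simpa using h2⟩
      simpa using h1 (k.succAbove j) (Fin.strictMono_succAbove k hj)
  · rintro ⟨i, h1, h2⟩
    refine ⟨k.succAbove i, fun j hj => ?_, by simpa using h2⟩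
    rcases Fin.eq_self_or_eq_succAbove k j with rfl | ⟨j', rfl⟩
    · simp
    · simpa using h1 j' ((Fin.strictMono_succAbove k).lt_iff_lt.1 hj)

theorem sl_sub {n t : ℕ} {k : Fin (n+1)} {a : ℕ} {M : Finset (Fin (n+1) → ℕ)}
    (hM : M ⊆ degMon (n+1) t) : sl k a M ⊆ degMon n (t-a) := by
  intro u hu
  have := mem_degMon.1 (hM (mem_sl.1 hu))
  rw [sum_insertNth] at this
  rw [mem_degMon]; omega

theorem sl_empty {n t : ℕ} {k : Fin (n+1)} {a : ℕ} {M : Finset (Fin (n+1) → ℕ)}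
    (hM : M ⊆ degMon (n+1) t) (ha : t < a) : sl k a M = ∅ := by
  rw [Finset.eq_empty_iff_forall_notMem]
  intro u hu
  have := mem_degMon.1 (hM (mem_sl.1 hu))
  rw [sum_insertNth] at this
  omega

theorem coord_le {n t : ℕ} {m : Fin n → ℕ} (h : m ∈ degMon n t) (k : Fin n) : m k ≤ t := by
  rw [← mem_degMon.1 h]
  exact Finset.single_le_sum (f := m) (fun _ _ => Nat.zero_le _) (Finset.mem_univ k)

theorem card_eq_sum_sl {n t : ℕ} (k : Fin (n+1)) {M : Finset (Fin (n+1) → ℕ)}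
    (hM : M ⊆ degMon (n+1) t) : M.card = ∑ a ∈ range (t+1), (sl k a M).card := by
  rw [Finset.card_eq_sum_card_fiberwise (f := fun m => m k) (t := range (t+1))]
  · exact Finset.sum_congr rfl (fun a _ => (card_sl k a M).symm)
  · intro m hm
    have := coord_le (hM hm) k
    simp; omega

theorem sum_eq_sum_sl {n t : ℕ} (k : Fin (n+1)) {M : Finset (Fin (n+1) → ℕ)}
    (hM : M ⊆ degMon (n+1) t) (w : (Fin (n+1) → ℕ) → ℕ) :
    ∑ m ∈ M, w m = ∑ a ∈ range (t+1), ∑ u ∈ sl k a M, w (k.insertNth a u) := by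
  rw [← Finset.sum_fiberwise_of_maps_to (g := fun m => m k) (t := range (t+1))]
  · refine Finset.sum_congr rfl (fun a _ => ?_)
    symm
    refine Finset.sum_bij (fun u _ => (k.insertNth a u : Fin (n+1) → ℕ)) ?_ ?_ ?_ ?_
    · intro u hu
      exact Finset.mem_filter.2 ⟨mem_sl.1 hu, by simp⟩
    · intro u _ v _ h
      exact Fin.insertNth_right_injective (p := k) _ h
    · intro m hm
      obtain ⟨h1, rfl⟩ := Finset.mem_filter.1 hm
      exact ⟨k.removeNth m, mem_sl.2 (by simpa using h1), by simp⟩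
    · intro _ _; rfl
  · intro m hm
    have := coord_le (hM hm) k
    simp; omega

theorem insertNth_add_succAbove {n : ℕ} (k : Fin (n+1)) (a : ℕ) (u : Fin n → ℕ) (i : Fin n) :
    (k.insertNth a (u + Pi.single i 1) : Fin (n+1) → ℕ)
      = k.insertNth a u + Pi.single (k.succAbove i) 1 := by
  funext j
  rcases Fin.eq_self_or_eq_succAbove k j with rfl | ⟨j', rfl⟩
  · simp
  · simp [Pi.single_apply]

theorem insertNth_add_self {n : ℕ} (k : Fin (n+1)) (a : ℕ) (u : Fin n → ℕ) :
    (k.insertNth (a+1) u : Fin (n+1) → ℕ) = k.insertNth a u + Pi.single k 1 := by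
  funext j
  rcases Fin.eq_self_or_eq_succAbove k j with rfl | ⟨j', rfl⟩
  · simp
  · simp

theorem sl_S1mul {n : ℕ} (k : Fin (n+1)) (a : ℕ) (M : Finset (Fin (n+1) → ℕ)) :
    sl k a (S1mul (n+1) M) = S1mul n (sl k a M) ∪ (if a = 0 then ∅ else sl k (a-1) M) := by
  ext u
  rw [mem_sl, mem_S1mul, Finset.mem_union, mem_S1mul]
  constructor
  · rintro ⟨i, m, hm, h⟩
    have hk := congrFun h k
    rcases Fin.eq_self_or_eq_succAbove k i with rfl | ⟨i', rfl⟩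
    · right
      simp at hk
      subst hk
      simp only [Nat.add_eq_zero_iff, one_ne_zero, and_false, if_false, Nat.add_sub_cancel]
      rw [insertNth_add_self] at h
      rw [mem_sl, ← add_right_cancel h]; exact hm
    · left
      simp at hk
      refine ⟨i', k.removeNth m, mem_sl.2 ?_, ?_⟩
      · rw [← hk]; simpa using hm
      · apply Fin.insertNth_right_injective (α := fun _ => ℕ) (p := k) a
        rw [insertNth_add_succAbove, ← h, ← hk]; simp
  · rintro (⟨i, m, hm, rfl⟩ | h)
    · exact ⟨k.succAbove i, _, mem_sl.1 hm, (insertNth_add_succAbove k a m i).symm⟩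
    · cases a with
      | zero => simp at h
      | succ a =>
        simp at h
        exact ⟨k, _, mem_sl.1 h, (insertNth_add_self k a u).symm⟩

/-- compression -/
def cmpr {n : ℕ} (k : Fin (n+1)) (t : ℕ) (M : Finset (Fin (n+1) → ℕ)) :
    Finset (Fin (n+1) → ℕ) :=
  (range (t+1)).biUnion fun a =>
    (lexSeg (degMon n (t-a)) (sl k a M).card).image (fun u => (k.insertNth a u : Fin (n+1) → ℕ))

theorem sl_cmpr {n t : ℕ} (k : Fin (n+1)) (a : ℕ) (ha : a ≤ t) (M : Finset (Fin (n+1) → ℕ)) :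
    sl k a (cmpr k t M) = lexSeg (degMon n (t-a)) (sl k a M).card := by
  ext u
  rw [mem_sl]
  simp only [cmpr, Finset.mem_biUnion, Finset.mem_image, Finset.mem_range]
  constructor
  · rintro ⟨b, hb, v, hv, h⟩
    have h1 := congrFun h k
    simp at h1
    subst h1
    have := Fin.insertNth_right_injective (α := fun _ => ℕ) (p := k) _ h
    exact this ▸ hv
  · intro h
    exact ⟨a, by omega, u, h, rfl⟩

theorem cmpr_sub {n t : ℕ} (k : Fin (n+1)) (M : Finset (Fin (n+1) → ℕ)) :
    cmpr k t M ⊆ degMon (n+1) t := by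
  intro m hm
  simp only [cmpr, Finset.mem_biUnion, Finset.mem_image, Finset.mem_range] at hm
  obtain ⟨b, hb, v, hv, rfl⟩ := hm
  have := mem_degMon.1 (Finset.mem_filter.1 hv).1
  rw [mem_degMon, sum_insertNth]; omega

theorem sl_cmpr_spec {n t : ℕ} (k : Fin (n+1)) (a : ℕ) {M : Finset (Fin (n+1) → ℕ)}
    (hM : M ⊆ degMon (n+1) t) :
    IsLexSeg (degMon n (t-a)) (sl k a (cmpr k t M)) ∧
      (sl k a (cmpr k t M)).card = (sl k a M).card := by
  by_cases ha : a ≤ t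
  · rw [sl_cmpr k a ha]
    exact lexSeg_spec (Finset.card_le_card (sl_sub hM))
  · rw [sl_empty (cmpr_sub k M) (by omega), sl_empty hM (by omega)]
    exact ⟨⟨by simp, by simp⟩, rfl⟩

theorem card_cmpr {n t : ℕ} (k : Fin (n+1)) {M : Finset (Fin (n+1) → ℕ)}
    (hM : M ⊆ degMon (n+1) t) : (cmpr k t M).card = M.card := by
  rw [card_eq_sum_sl k (cmpr_sub k M), card_eq_sum_sl k hM]
  exact Finset.sum_congr rfl (fun a _ => (sl_cmpr_spec k a hM).2)

theorem card_sl_S1mul_cmpr {n t : ℕ} (k : Fin (n+1)) (a : ℕ) (ha : a ≤ t + 1)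
    {M : Finset (Fin (n+1) → ℕ)} (hM : M ⊆ degMon (n+1) t) :
    (sl k a (S1mul (n+1) (cmpr k t M))).card =
      max (S1mul n (sl k a (cmpr k t M))).card (if a = 0 then 0 else (sl k (a-1) M).card) := by
  rw [sl_S1mul]
  by_cases h0 : a = 0
  · simp [h0]
  · simp only [h0, if_false]
    rw [← (sl_cmpr_spec k (a-1) hM).2]
    have h2 := (sl_cmpr_spec k (a-1) hM).1
    rw [show t - (a-1) = t + 1 - a by omega] at h2
    refine card_union_lexSeg (G := degMon n (t+1-a)) ?_ h2
    by_cases h1 : a = t + 1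
    · rw [sl_empty (cmpr_sub k M) (by omega)]
      constructor <;> simp [S1mul]
    · have := S1mul_lex (sl_cmpr_spec k a hM).1
      rwa [show t - a + 1 = t + 1 - a by omega] at this

def Mac (n : ℕ) : Prop := ∀ t : ℕ, ∀ M ⊆ degMon n t, ∀ L, IsLexSeg (degMon n t) L →
  L.card = M.card → (S1mul n L).card ≤ (S1mul n M).card

theorem cmpr_slice_le {n t : ℕ} (hMac : Mac n) (k : Fin (n+1)) (a : ℕ) (ha : a ≤ t + 1)
    {M : Finset (Fin (n+1) → ℕ)} (hM : M ⊆ degMon (n+1) t) :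
    (sl k a (S1mul (n+1) (cmpr k t M))).card ≤ (sl k a (S1mul (n+1) M)).card := by
  rw [card_sl_S1mul_cmpr k a ha hM, sl_S1mul]
  refine max_le ?_ ?_
  · refine (hMac (t-a) _ (sl_sub hM) _ (sl_cmpr_spec k a hM).1 (sl_cmpr_spec k a hM).2).trans ?_
    exact Finset.card_le_card Finset.subset_union_left
  · split_ifs with h
    · exact Nat.zero_le _
    · exact Finset.card_le_card Finset.subset_union_right

theorem cmpr_le {n t : ℕ} (hMac : Mac n) (k : Fin (n+1))
    {M : Finset (Fin (n+1) → ℕ)} (hM : M ⊆ degMon (n+1) t) :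
    (S1mul (n+1) (cmpr k t M)).card ≤ (S1mul (n+1) M).card := by
  rw [card_eq_sum_sl k (S1mul_sub (cmpr_sub k M)), card_eq_sum_sl k (S1mul_sub hM)]
  refine Finset.sum_le_sum (fun a ha => cmpr_slice_le hMac k a ?_ hM)
  have := Finset.mem_range.1 ha
  omega

/-- potential comparison -/
theorem pot_le {n : ℕ} {G A L : Finset (Fin n → ℕ)} (hA : A ⊆ G) (hL : IsLexSeg G L)
    (hc : L.card = A.card) (f : (Fin n → ℕ) → ℕ)
    (hf : ∀ u ∈ G, ∀ v ∈ G, lexLt u v → f u < f v) :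
    ∑ u ∈ A, f u ≤ ∑ u ∈ L, f u ∧ (∑ u ∈ A, f u = ∑ u ∈ L, f u → A = L) := by
  by_cases hAL : A = L
  · subst hAL; simp
  have hcd : (A \ L).card = (L \ A).card := by
    have h1 := Finset.card_sdiff_add_card_inter A L
    have h2 := Finset.card_sdiff_add_card_inter L A
    rw [Finset.inter_comm] at h2
    omega
  have hne : (A \ L).Nonempty := by
    rw [Finset.sdiff_nonempty]
    intro h
    exact hAL (Finset.eq_of_subset_of_card_le h hc.le)
  have hlt : ∑ u ∈ A \ L, f u < ∑ u ∈ L \ A, f u := by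
    have hne' : (L \ A).Nonempty := by rw [← Finset.card_pos, ← hcd]; exact hne.card_pos
    obtain ⟨c, hcm, hcmin⟩ := Finset.exists_min_image (L \ A) f hne'
    have h1 : ∑ u ∈ A \ L, f u < ∑ u ∈ A \ L, f c := by
      refine Finset.sum_lt_sum_of_nonempty hne (fun u hu => ?_)
      rw [Finset.mem_sdiff] at hu hcm
      apply hf u (hA hu.1) c (hL.1 hcm.1)
      rcases lexLt_tri u c with h | h | h
      · exact h
      · exact absurd (h ▸ hu.1) hcm.2
      · exact absurd (hL.2 c hcm.1 u (hA hu.1) h) hu.2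
    have h2 : ∑ u ∈ A \ L, f c = ∑ u ∈ L \ A, f c := by simp [hcd]
    have h3 : ∑ u ∈ L \ A, f c ≤ ∑ u ∈ L \ A, f u := Finset.sum_le_sum hcmin
    omega
  have e1 := Finset.sum_inter_add_sum_sdiff A L f
  have e2 := Finset.sum_inter_add_sum_sdiff L A f
  rw [Finset.inter_comm] at e2
  constructor
  · omega
  · intro h; omega

/-- weight -/
def wt {n : ℕ} (t : ℕ) (m : Fin n → ℕ) : ℕ := ((degMon n t).filter (fun v => lexLt v m)).card

theorem wt_lt {n t : ℕ} {u v : Fin n → ℕ} (hu : u ∈ degMon n t) (h : lexLt u v) :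
    wt t u < wt t v := by
  apply Finset.card_lt_card
  rw [Finset.ssubset_iff_of_subset]
  · exact ⟨u, Finset.mem_filter.2 ⟨hu, h⟩, fun h' => lexLt_irr (Finset.mem_filter.1 h').2⟩
  · intro x hx
    rw [Finset.mem_filter] at hx ⊢
    exact ⟨hx.1, lexLt_trans hx.2 h⟩

def StarP {n : ℕ} (t : ℕ) (N : Finset (Fin n → ℕ)) : Prop :=
  ∀ k : Fin n, ∀ m ∈ N, ∀ v ∈ degMon n t, v k = m k → lexLt m v → v ∈ N

theorem exists_star {n t : ℕ} (hMac : Mac n) {M : Finset (Fin (n+1) → ℕ)}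
    (hM : M ⊆ degMon (n+1) t) :
    ∃ N ⊆ degMon (n+1) t, N.card = M.card ∧ (S1mul (n+1) N).card ≤ (S1mul (n+1) M).card ∧
      StarP t N := by
  set F := (degMon (n+1) t).powerset.filter
    (fun N => N.card = M.card ∧ (S1mul (n+1) N).card ≤ (S1mul (n+1) M).card) with hF
  have hne : F.Nonempty := ⟨M, by simp [hF, hM]⟩
  obtain ⟨N, hN, hmax⟩ := Finset.exists_max_image F (fun N => ∑ m ∈ N, wt t m) hne
  simp only [hF, Finset.mem_filter, Finset.mem_powerset] at hN hmax
  obtain ⟨hN, hcN, hsN⟩ := hN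
  refine ⟨N, hN, hcN, hsN, ?_⟩
  intro k m hm v hv hvk hlt
  have hle := hmax (cmpr k t N) ⟨cmpr_sub k N, (card_cmpr k hN).trans hcN, (cmpr_le hMac k hN).trans hsN⟩
  rw [sum_eq_sum_sl k hN, sum_eq_sum_sl k (cmpr_sub k N)] at hle
  have hpot : ∀ a ∈ range (t+1), _ := fun a ha => 
    pot_le (sl_sub hN) (sl_cmpr_spec k a hN).1 (sl_cmpr_spec k a hN).2
      (fun u => wt t (k.insertNth a u : Fin (n+1) → ℕ)) (by
        intro u hu v hv h
        have := Finset.mem_range.1 ha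
        refine wt_lt ?_ ((lexLt_insertNth k a u v).2 h)
        rw [mem_degMon, sum_insertNth, mem_degMon.1 hu]; omega)
  have heq := (Finset.sum_eq_sum_iff_of_le (fun a ha => (hpot a ha).1)).1
    (le_antisymm (Finset.sum_le_sum (fun a ha => (hpot a ha).1)) hle)
  have hmk : m k ∈ range (t+1) := by
    have := coord_le (hN hm) k
    simp; omega
  have hsl := (hpot (m k) hmk).2 (heq (m k) hmk)
  have hlex := (sl_cmpr_spec k (m k) hN).1
  rw [← hsl] at hlex
  have h1 : k.removeNth m ∈ sl k (m k) N := mem_sl.2 (by simpa using hm)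
  have h2 : k.removeNth v ∈ sl k (m k) N := by
    refine hlex.2 _ h1 _ ?_ ?_
    · have e := mem_degMon.1 hv
      rw [← Fin.insertNth_self_removeNth k v, sum_insertNth] at e
      rw [mem_degMon]; omega
    · rw [← lexLt_insertNth k (m k)]
      nth_rewrite 2 [← hvk]
      simpa using hlt
  rw [mem_sl, ← hvk] at h2
  simpa using h2

def Exch {n : ℕ} (N : Finset (Fin (n+1) → ℕ)) : Prop :=
  ∀ m : Fin (n+1) → ℕ, m + Pi.single (Fin.last n) 1 ∈ N → ∀ i, i ≠ Fin.last n →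
    m + Pi.single i 1 ∈ N

theorem exch_lexLt {n : ℕ} (m : Fin (n+1) → ℕ) {i : Fin (n+1)} (hi : i ≠ Fin.last n) :
    lexLt (m + Pi.single (Fin.last n) 1) (m + Pi.single i 1) := by
  have hil : i < Fin.last n := lt_of_le_of_ne (Fin.le_last i) hi
  refine ⟨i, fun j hj => ?_, ?_⟩
  · simp [Pi.single_eq_of_ne hj.ne, Pi.single_eq_of_ne (hj.trans hil).ne]
  · simp [Pi.single_eq_of_ne hi]

theorem exch_deg {n t : ℕ} {m : Fin n → ℕ} {i j : Fin n}
    (h : m + Pi.single i 1 ∈ degMon n t) : m + Pi.single j 1 ∈ degMon n t := by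
  rw [mem_degMon, sum_add_single] at h ⊢
  exact h

theorem exch_of_lex {n t : ℕ} {L : Finset (Fin (n+1) → ℕ)} (hL : IsLexSeg (degMon (n+1) t) L) :
    Exch L := by
  intro m hm i hi
  exact hL.2 _ hm _ (exch_deg (hL.1 hm)) (exch_lexLt m hi)

theorem exch_of_star {n t : ℕ} (hn : 2 ≤ n) {N : Finset (Fin (n+1) → ℕ)}
    (hN : N ⊆ degMon (n+1) t) (hS : StarP t N) : Exch N := by
  intro m hm i hi
  obtain ⟨k, hk⟩ : ∃ k, k ∉ ({i, Fin.last n} : Finset (Fin (n+1))) := by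
    by_contra hcon
    push Not at hcon
    have h1 : (Finset.univ : Finset (Fin (n+1))) ⊆ {i, Fin.last n} := fun x _ => hcon x
    have h2 := Finset.card_le_card h1
    have h3 := Finset.card_le_two (a := i) (b := Fin.last n)
    simp at h2
    omega
  simp only [Finset.mem_insert, Finset.mem_singleton, not_or] at hk
  refine hS k _ hm _ (exch_deg (hN hm)) ?_ (exch_lexLt m hi)
  simp [Pi.single_eq_of_ne hk.1, Pi.single_eq_of_ne hk.2]

theorem card_S1mul_exch {n : ℕ} {N : Finset (Fin (n+1) → ℕ)} (hE : Exch N) :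
    (S1mul (n+1) N).card =
      N.card + ((S1mul (n+1) N).filter (fun m => m (Fin.last n) = 0)).card := by
  have h1 : ((S1mul (n+1) N).filter (fun m => ¬ m (Fin.last n) = 0))
      = N.image (fun m => m + Pi.single (Fin.last n) 1) := by
    ext v
    simp only [Finset.mem_filter, Finset.mem_image]
    constructor
    · rintro ⟨hv, h0⟩
      obtain ⟨i, m, hm, rfl⟩ := mem_S1mul.1 hv
      by_cases hi : i = Fin.last n
      · subst hi; exact ⟨m, hm, rfl⟩
      · have : 0 < m (Fin.last n) := by
          simp [Pi.single_eq_of_ne (Ne.symm hi)] at h0; omega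
        obtain ⟨m', rfl⟩ := add_single_of_pos m _ this
        exact ⟨m' + Pi.single i 1, hE m' hm i hi, by abel⟩
    · rintro ⟨m, hm, rfl⟩
      exact ⟨mem_S1mul.2 ⟨_, m, hm, rfl⟩, by simp⟩
  have h2 := Finset.card_filter_add_card_filter_not (s := S1mul (n+1) N)
    (fun m => m (Fin.last n) = 0)
  rw [h1, Finset.card_image_of_injective _ (fun a b h => add_right_cancel h)] at h2
  omega

theorem final_cmp {n t : ℕ} {N L : Finset (Fin (n+2) → ℕ)}
    (hN : N ⊆ degMon (n+2) t) (hS : StarP t N) (hE : Exch N)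
    (hL : IsLexSeg (degMon (n+2) t) L) (hc : L.card = N.card) :
    (S1mul (n+2) L).card ≤ (S1mul (n+2) N).card := by
  have key : ∀ u ∈ L, u (Fin.last (n+1)) = 0 → u ∈ N := by
    intro u hu hu0
    by_contra huN
    have hsu := mem_degMon.1 (hL.1 hu)
    have hall : ∀ b : ℕ, ∀ m ∈ N, m (Fin.last (n+1)) = b → lexLt u m := by
      intro b
      induction b with
      | zero =>
        intro m hm h0
        rcases lexLt_tri u m with h | h | h
        · exact h
        · exact absurd (h ▸ hm) huN
        · exact absurd (hS (Fin.last (n+1)) m hm u (hL.1 hu) (by rw [hu0, h0]) h) huN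
      | succ b ih =>
        intro m hm h0
        obtain ⟨m', rfl⟩ := add_single_of_pos m (Fin.last (n+1)) (by omega)
        have hi : (Fin.last n).castSucc ≠ Fin.last (n+1) := (Fin.castSucc_lt_last _).ne
        have hm2 := hE m' hm _ hi
        simp at h0
        obtain ⟨p, hp1, hp2⟩ := ih _ hm2 (by simpa [Pi.single_eq_of_ne hi.symm] using h0)
        by_cases hp : p < (Fin.last n).castSucc
        · refine ⟨p, fun j hj => ?_, ?_⟩
          · have := hp1 j hj
            rw [this]
            have h3 := hj.trans hp
            simp [Pi.single_eq_of_ne h3.ne, Pi.single_eq_of_ne (h3.trans (Fin.castSucc_lt_last _)).ne]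
          · simp [Pi.single_eq_of_ne hp.ne] at hp2
            simp only [Pi.add_apply]
            omega
        · exfalso
          refine le_lex_absurd (hsu.trans (mem_degMon.1 (hN hm2)).symm) p ?_ hp2
          intro k
          rcases lt_trichotomy k p with h | h | h
          · exact (hp1 k h).le
          · subst h; exact hp2.le
          · have : k = Fin.last (n+1) := by
              have h4 := lt_of_le_of_lt (not_lt.1 hp) h
              apply Fin.ext
              have := k.2
              rw [Fin.lt_def] at h4
              simp at h4 ⊢
              omega
            rw [this, hu0]; exact Nat.zero_le _
    have : N ⊂ L := by
      refine Finset.ssubset_iff_subset_ne.2 ⟨?_, fun h => huN (h ▸ hu)⟩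
      intro m hm
      exact hL.2 u hu m (hN hm) (hall _ m hm rfl)
    have := Finset.card_lt_card this
    omega
  rw [card_S1mul_exch hE, card_S1mul_exch (exch_of_lex hL), hc]
  refine Nat.add_le_add_left (Finset.card_le_card ?_) _
  intro v hv
  rw [Finset.mem_filter] at hv ⊢
  refine ⟨?_, hv.2⟩
  obtain ⟨i, m, hm, rfl⟩ := mem_S1mul.1 hv.1
  have h0 := hv.2
  simp at h0
  exact mem_S1mul.2 ⟨i, m, key m hm h0.1, rfl⟩

theorem mac_zero : Mac 0 := by
  intro t M hM L hL hc
  simp [S1mul]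

theorem mac_one : Mac 1 := by
  intro t M hM L hL hc
  have hsing : ∀ u ∈ degMon 1 t, ∀ v ∈ degMon 1 t, u = v := by
    intro u hu v hv
    rw [mem_degMon] at hu hv
    simp at hu hv
    funext i
    rw [Subsingleton.elim i 0, hu, hv]
  apply Finset.card_le_card
  apply S1mul_mono
  intro u hu
  have : 0 < M.card := by rw [← hc]; exact Finset.card_pos.2 ⟨u, hu⟩
  obtain ⟨v, hv⟩ := Finset.card_pos.1 this
  rw [hsing u (hL.1 hu) v (hM hv)]
  exact hv

theorem mac_two : Mac 2 := by
  intro t M hM L hL hc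
  rcases M.eq_empty_or_nonempty with rfl | hne
  · have : L = ∅ := by simpa using hc
    subst this; exact le_rfl
  rw [card_S1mul_exch (n := 1) (exch_of_lex hL), hc]
  have h1 : ((S1mul 2 L).filter (fun m => m (Fin.last 1) = 0)).card ≤ 1 := by
    rw [Finset.card_le_one]
    intro a ha b hb
    rw [Finset.mem_filter] at ha hb
    have ha1 := mem_degMon.1 (S1mul_sub hL.1 ha.1)
    have hb1 := mem_degMon.1 (S1mul_sub hL.1 hb.1)
    have ha2 : a 1 = 0 := ha.2
    have hb2 : b 1 = 0 := hb.2
    simp [Fin.sum_univ_two] at ha1 hb1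
    funext i
    fin_cases i
    · show a 0 = b 0
      omega
    · show a 1 = b 1
      omega
  obtain ⟨m, hm, hmin⟩ := Finset.exists_min_image M (fun m => m 0) hne
  have h2 : insert (m + Pi.single 1 1) (M.image (fun m => m + Pi.single (0 : Fin 2) 1)) ⊆ S1mul 2 M := by
    intro v hv
    rcases Finset.mem_insert.1 hv with rfl | hv
    · exact mem_S1mul.2 ⟨1, m, hm, rfl⟩
    · obtain ⟨m', hm', rfl⟩ := Finset.mem_image.1 hv
      exact mem_S1mul.2 ⟨0, m', hm', rfl⟩
  have h3 := Finset.card_le_card h2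
  rw [Finset.card_insert_of_notMem, Finset.card_image_of_injective _ (fun a b h => add_right_cancel h)] at h3
  · exact (Nat.add_le_add_left h1 _).trans h3
  · intro hcon
    obtain ⟨m', hm', he⟩ := Finset.mem_image.1 hcon
    have h4 := congrFun he 0
    simp at h4
    have := hmin m' hm'
    omega

theorem mac : ∀ n, Mac n
  | 0 => mac_zero
  | 1 => mac_one
  | 2 => mac_two
  | (n+3) => by
    intro t M hM L hL hc
    obtain ⟨N, hN, hcN, hsN, hS⟩ := exists_star (mac (n+2)) hM
    exact (final_cmp hN hS (exch_of_star (by omega) hN hS) hL (hc.trans hcN.symm)).trans hsN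

/-- translation by the first variable -/
theorem shift_lex {k t : ℕ} {L : Finset (Fin (k+1) → ℕ)} (hL : IsLexSeg (degMon (k+1) t) L) :
    ∃ L', IsLexSeg (degMon (k+1) (t+1)) L' ∧ L'.card = L.card ∧
      (S1mul (k+1) L').card = (S1mul (k+1) L).card := by
  have hinj : Function.Injective (fun m : Fin (k+1) → ℕ => m + Pi.single 0 1) :=
    fun a b h => add_right_cancel h
  refine ⟨L.image (fun m => m + Pi.single 0 1), ⟨?_, ?_⟩, ?_, ?_⟩
  · intro v hv
    obtain ⟨m, hm, rfl⟩ := Finset.mem_image.1 hv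
    rw [mem_degMon, sum_add_single, mem_degMon.1 (hL.1 hm)]
  · intro w hw v hv hlt
    obtain ⟨m, hm, rfl⟩ := Finset.mem_image.1 hw
    obtain ⟨p, hp1, hp2⟩ := hlt
    have hpos : 0 < v 0 := by
      rcases eq_or_ne p 0 with rfl | h
      · exact lt_of_le_of_lt (Nat.zero_le _) hp2
      · rw [← hp1 0 (Fin.pos_of_ne_zero h)]; simp
    obtain ⟨v', rfl⟩ := add_single_of_pos v 0 hpos
    rw [mem_degMon, sum_add_single] at hv
    refine Finset.mem_image.2 ⟨v', hL.2 m hm v' (mem_degMon.2 (by omega)) ⟨p, ?_, ?_⟩, rfl⟩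
    · intro j hj
      exact add_right_cancel (hp1 j hj)
    · exact lt_of_add_lt_add_right hp2
  · exact Finset.card_image_of_injective _ hinj
  · rw [← Finset.card_image_of_injective (S1mul (k+1) L) hinj]
    congr 1
    ext v
    simp only [mem_S1mul, Finset.mem_image]
    constructor
    · rintro ⟨i, _, ⟨m, hm, rfl⟩, rfl⟩
      exact ⟨_, ⟨i, m, hm, rfl⟩, by abel⟩
    · rintro ⟨_, ⟨i, m, hm, rfl⟩, rfl⟩
      exact ⟨i, _, ⟨m, hm, rfl⟩, by abel⟩

theorem shift_lex_many {k t : ℕ} (s : ℕ) {L : Finset (Fin (k+1) → ℕ)}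
    (hL : IsLexSeg (degMon (k+1) t) L) :
    ∃ L', IsLexSeg (degMon (k+1) (t+s)) L' ∧ L'.card = L.card ∧
      (S1mul (k+1) L').card = (S1mul (k+1) L).card := by
  induction s with
  | zero => exact ⟨L, hL, rfl, rfl⟩
  | succ s ih =>
    obtain ⟨L', h1, h2, h3⟩ := ih
    obtain ⟨L'', h4, h5, h6⟩ := shift_lex h1
    exact ⟨L'', h4, h5.trans h2, h6.trans h3⟩

theorem le_card_degMon {k t : ℕ} {d : ℕ} (hd : d ≤ (degMon (k+1) t).card) :
    d ≤ (degMon (k+1) d).card := by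
  cases k with
  | zero =>
    have : (degMon 1 t).card ≤ 1 := by
      rw [Finset.card_le_one]
      intro u hu v hv
      rw [mem_degMon] at hu hv
      simp at hu hv
      funext i
      rw [Subsingleton.elim i 0, hu, hv]
    have h1 : 0 < (degMon 1 d).card :=
      Finset.card_pos.2 ⟨fun _ => d, mem_degMon.2 (by simp)⟩
    change d ≤ (degMon 1 t).card at hd
    change d ≤ (degMon 1 d).card
    omega
  | succ k =>
    have : (range d).card ≤ (degMon (k+1+1) d).card := by
      refine Finset.card_le_card_of_injOn
        (fun a => (Pi.single 0 a + Pi.single 1 (d - a) : Fin (k+2) → ℕ)) ?_ ?_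
      · intro a ha
        have := Finset.mem_range.1 ha
        show _ ∈ degMon (k+2) d
        rw [mem_degMon]
        simp [Finset.sum_add_distrib]
        omega
      · intro a _ b _ h
        simpa using congrFun h 0
    simpa using this

theorem growth_eq {k t : ℕ} {L : Finset (Fin (k+1) → ℕ)} (hL : IsLexSeg (degMon (k+1) t) L) :
    growth L.card k = (S1mul (k+1) L).card := by
  have h0 := lexSeg_spec (le_card_degMon (Finset.card_le_card hL.1))
  obtain ⟨A, hA1, hA2, hA3⟩ := shift_lex_many t h0.1
  obtain ⟨B, hB1, hB2, hB3⟩ := shift_lex_many L.card hL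
  rw [add_comm L.card t] at hA1
  have : A = B := by
    apply Finset.Subset.antisymm
    · exact lexSeg_sub_of hA1 hB1 (by rw [hA2, hB2, h0.2])
    · exact lexSeg_sub_of hB1 hA1 (by rw [hA2, hB2, h0.2])
  rw [growth, ← hA3, ← hB3, this]

theorem card_comp {n : ℕ} (M : Finset (Fin (n+1) → ℕ)) (i : ℕ) :
    (comp M i).card = (sl 0 i M).card := by
  rw [card_sl]
  simp [comp, x1exp]

/-- Let `M` be a Gotzmann set of degree-`t` monomials in `S` and
`d_i = |M^i|` (with `d_{-1} = 0`).  Then for every `0 ≤ i ≤ t + 1`,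
`|(S_1·M)^i| = max { d_i^{<n-2>}, d_{i-1} }`. -/
theorem stmt_9 (n t : ℕ) (hn : 2 ≤ n) (M : Finset (Fin n → ℕ)) (hM : M ⊆ degMon n t)
    (hG : GotzmannS n t M) :
    ∀ i : ℕ, i ≤ t + 1 →
      (comp (S1mul n M) i).card =
        max (growth ((comp M i).card) (n - 2))
          (if i = 0 then 0 else (comp M (i - 1)).card) := by

  obtain ⟨k, rfl⟩ : ∃ k, n = k + 2 := ⟨n - 2, by omega⟩
  intro i hi
  have hle : ∀ a ∈ range (t+1+1), _ := fun a ha =>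
    cmpr_slice_le (mac (k+1)) (0 : Fin (k+1+1)) a
      (by have := Finset.mem_range.1 ha; omega) hM
  have hlex := lexSeg_spec (Finset.card_le_card hM)
  have h1 := mac (k+2) t (cmpr (0 : Fin (k+1+1)) t M) (cmpr_sub _ M) _ hlex.1
    (hlex.2.trans (card_cmpr _ hM).symm)
  rw [hG, card_eq_sum_sl (0 : Fin (k+1+1)) (S1mul_sub hM),
    card_eq_sum_sl (0 : Fin (k+1+1)) (S1mul_sub (cmpr_sub _ M))] at h1
  have heq := (Finset.sum_eq_sum_iff_of_le hle).1 (le_antisymm (Finset.sum_le_sum hle) h1)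
    i (Finset.mem_range.2 (by omega))
  rw [card_sl_S1mul_cmpr _ i hi hM] at heq
  rw [card_comp, card_comp, card_comp, ← heq, ← growth_eq (sl_cmpr_spec 0 i hM).1,
    (sl_cmpr_spec 0 i hM).2]
  rfl
end
end

section
/- Let d, n, t be positive integers with n ≥ 2, and suppose d is smaller than the number of monomials in R_t^{(n)} and in R_t^{(n+1)} (the degree-t components of F[x_1,...,x_n]/(x_1^a) and F[x_1,...,x_{n+1}]/(x_1^a) respectively). Then d_{n+1,t} > d_{n,t}. -/
open scoped Classical
open Finset

noncomputable section

def WL : ℕ → ℕ → List ℕ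
  | 0, _ => [1]
  | k+1, 0 => [k+2]
  | k+1, t+1 => WL (k+1) t ++ WL k (t+1)

def PS (l : List ℕ) (d : ℕ) : ℕ := (l.take d).sum

theorem PS_zero (l : List ℕ) : PS l 0 = 0 := by simp [PS]

theorem PS_app_le (l l' : List ℕ) (d : ℕ) (h : d ≤ l.length) : PS (l ++ l') d = PS l d := by
  simp [PS, List.take_append_of_le_length h]

theorem PS_app_add (l l' : List ℕ) (e : ℕ) :
    PS (l ++ l') (l.length + e) = PS l l.length + PS l' e := by
  simp [PS, List.take_append, List.take_of_length_le]

theorem WL_len_pos (k t : ℕ) : 1 ≤ (WL k t).length := by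
  induction t with
  | zero => cases k <;> simp [WL]
  | succ t ih => 
    cases k with
    | zero => simp [WL]
    | succ k => simp only [WL, List.length_append]; omega

theorem WL_len_succ (k t : ℕ) : (WL k t).length ≤ (WL k (t+1)).length := by
  cases k with
  | zero => simp [WL]
  | succ k => simp only [WL, List.length_append]; omega

theorem WL_len_mono (k : ℕ) {s t : ℕ} (h : s ≤ t) : (WL k s).length ≤ (WL k t).length :=
  monotone_nat_of_le_succ (WL_len_succ k) h

theorem WL_len_k (k t : ℕ) : (WL k t).length ≤ (WL (k+1) t).length := by
  cases t with
  | zero => cases k <;> simp [WL]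
  | succ t => simp only [WL, List.length_append]; omega

theorem WL_pre (k : ℕ) {s t : ℕ} (h : s ≤ t) (d : ℕ) (hd : d ≤ (WL k s).length) :
    PS (WL k t) d = PS (WL k s) d := by
  induction t, h using Nat.le_induction with
  | base => rfl
  | succ t hst ih =>
    cases k with
    | zero => simp [WL]
    | succ k =>
      rw [← ih]
      simp only [WL]
      exact PS_app_le _ _ _ (hd.trans (WL_len_mono _ hst))

theorem WL_one (k t : ℕ) : PS (WL k t) 1 = k + 1 := by
  rw [WL_pre k (Nat.zero_le t) 1 (WL_len_pos k 0)]
  cases k <;> simp [WL, PS]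

def CD (L : List ℕ) (p b : ℕ) : Prop :=
  (p + b ≤ L.length → PS L (p+b) ≤ PS L p + PS L b ∧
    (1 ≤ p → 1 ≤ b → PS L (p+b) < PS L p + PS L b)) ∧
  (L.length ≤ p + b → PS L L.length + PS L (p+b-L.length) ≤ PS L p + PS L b)

theorem CD_symm {L : List ℕ} {p b : ℕ} (h : CD L p b) : CD L b p := by
  unfold CD at *
  rw [add_comm b p, add_comm (PS L b)]
  exact ⟨fun h' => ⟨(h.1 h').1, fun x y => (h.1 h').2 y x⟩, h.2⟩

theorem CD_single (L : List ℕ) (hL : L.length = 1) (p b : ℕ) (hp : p ≤ 1) (hb : b ≤ 1) :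
    CD L p b := by
  unfold CD
  have := PS_zero L
  interval_cases p <;> interval_cases b <;> simp [hL, this]

theorem CD_E (k t : ℕ)
    (hC : ∀ p b, p ≤ (WL k (t+1)).length → b ≤ (WL k (t+1)).length → CD (WL k (t+1)) p b) :
    ∀ j ≤ t+1, ∀ q ≤ (WL k (t+1)).length, ∀ b ≤ (WL (k+1) j).length,
      CD (WL (k+1) (t+1)) ((WL (k+1) t).length + q) b := by
  have hlen : (WL (k+1) (t+1)).length = (WL (k+1) t).length + (WL k (t+1)).length := by
    simp [WL]
  have hadd : ∀ e, PS (WL (k+1) (t+1)) ((WL (k+1) t).length + e) =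
      PS (WL (k+1) (t+1)) (WL (k+1) t).length + PS (WL k (t+1)) e := by
    intro e
    simp only [WL]
    rw [PS_app_add, PS_app_le _ _ _ le_rfl]
  have hN := WL_len_pos (k+1) t
  intro j
  induction j with
  | zero =>
    intro _ q hq b hb
    have hb1 : b ≤ 1 := by simpa [WL] using hb
    have h0 := PS_zero (WL (k+1) (t+1))
    have h1 := WL_one (k+1) (t+1)
    have h1' := WL_one k (t+1)
    have hM := WL_len_pos k (t+1)
    interval_cases b
    · refine ⟨fun _ => ⟨by simp [h0], by omega⟩, fun h => ?_⟩
      have : q = (WL k (t+1)).length := by omega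
      subst this
      rw [← hlen]; simp [h0]
    · refine ⟨fun h => ?_, fun h => ?_⟩
      · have := ((hC q 1 hq hM).1 (by omega)).1
        rw [add_assoc, hadd, hadd]
        omega
      · rcases hq.lt_or_eq with hq' | rfl
        · have h2 := ((hC q 1 hq hM).1 (by omega)).1
          have h3 : (WL (k+1) t).length + q + 1 = (WL (k+1) (t+1)).length := by omega
          rw [h3, Nat.sub_self, ← h3, add_assoc, hadd, hadd]
          omega
        · rw [← hlen]; simp
  | succ j ih =>
    intro hj q hq b hb
    by_cases hbj : b ≤ (WL (k+1) j).length
    · exact ih (by omega) q hq b hbj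
    have hlenj : (WL (k+1) (j+1)).length = (WL (k+1) j).length + (WL k (j+1)).length := by
      simp [WL]
    obtain ⟨r, rfl⟩ : ∃ r, b = (WL (k+1) j).length + r := ⟨b - (WL (k+1) j).length, by omega⟩
    have hMM := WL_len_mono k hj
    have hbr : PS (WL (k+1) (t+1)) ((WL (k+1) j).length + r) =
        PS (WL (k+1) (t+1)) (WL (k+1) j).length + PS (WL k (t+1)) r := by
      rw [WL_pre (k+1) hj _ hb, WL_pre (k+1) (show j ≤ t+1 by omega) _ le_rfl,
        WL_pre k hj r (by omega)]
      simp only [WL]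
      rw [PS_app_add]
    have hr : r ≤ (WL k (t+1)).length := by omega
    have hc := hC q r hq hr
    have hNj := WL_len_pos (k+1) j
    by_cases hqr : q + r ≤ (WL k (t+1)).length
    · have hI := ih (by omega) (q+r) hqr _ le_rfl
      have h2 := (hc.1 hqr).1
      have e1 : (WL (k+1) t).length + q + ((WL (k+1) j).length + r) =
        (WL (k+1) t).length + (q + r) + (WL (k+1) j).length := by omega
      have a1 := hadd q
      have a2 := hadd (q+r)
      unfold CD at hI ⊢
      rw [e1]
      refine ⟨fun h => ⟨?_, fun _ _ => ?_⟩, fun h => ?_⟩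
      · have := (hI.1 h).1
        omega
      · have := (hI.1 h).2 (by omega) hNj
        omega
      · have := hI.2 h
        omega
    · have h2 := hc.2 (by omega)
      have a1 := hadd q
      have a2 := hadd (WL k (t+1)).length
      refine ⟨fun h => by omega, fun h => ?_⟩
      have hI := ih (by omega) (WL k (t+1)).length le_rfl
        ((WL (k+1) j).length) le_rfl
      have e1 : (WL (k+1) t).length + q + ((WL (k+1) j).length + r) - (WL (k+1) (t+1)).length
        = (WL (k+1) j).length + (q + r - (WL k (t+1)).length) := by omega
      have hb' : PS (WL (k+1) (t+1)) ((WL (k+1) j).length + (q + r - (WL k (t+1)).length)) =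
        PS (WL (k+1) (t+1)) (WL (k+1) j).length + PS (WL k (t+1)) (q + r - (WL k (t+1)).length) := by
        rw [WL_pre (k+1) hj _ (by omega), WL_pre (k+1) (show j ≤ t+1 by omega) _ le_rfl,
          WL_pre k hj (q + r - (WL k (t+1)).length) (by omega)]
        simp only [WL]
        rw [PS_app_add]
      rw [e1, hb', hbr, a1, hlen, a2]
      omega

theorem CD_all (k : ℕ) : ∀ t p b, p ≤ (WL k t).length → b ≤ (WL k t).length →
    CD (WL k t) p b := by
  induction k with
  | zero =>
    intro t p b hp hb
    exact CD_single _ (by simp [WL]) _ _ (by simpa [WL] using hp) (by simpa [WL] using hb)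
  | succ k ihk =>
    intro t
    induction t with
    | zero =>
      intro p b hp hb
      exact CD_single _ (by simp [WL]) _ _ (by simpa [WL] using hp) (by simpa [WL] using hb)
    | succ t iht =>
      have hE := CD_E k t (ihk (t+1)) (t+1) le_rfl
      have hlen : (WL (k+1) (t+1)).length = (WL (k+1) t).length + (WL k (t+1)).length := by
        simp [WL]
      have key : ∀ p b, (WL (k+1) t).length ≤ p → p ≤ (WL (k+1) (t+1)).length →
          b ≤ (WL (k+1) (t+1)).length → CD (WL (k+1) (t+1)) p b := by
        intro p b h1 h2 h3
        have := hE (p - (WL (k+1) t).length) (by omega) b h3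
        rwa [Nat.add_sub_cancel' h1] at this
      intro p b hp hb
      by_cases h1 : (WL (k+1) t).length ≤ p
      · exact key p b h1 hp hb
      by_cases h2 : (WL (k+1) t).length ≤ b
      · exact CD_symm (key b p h2 hb hp)
      push Not at h1 h2
      have hI := iht p b h1.le h2.le
      have pre : ∀ x, x ≤ (WL (k+1) t).length → PS (WL (k+1) (t+1)) x = PS (WL (k+1) t) x :=
        fun x hx => WL_pre (k+1) (Nat.le_succ t) x hx
      have hN := WL_len_pos (k+1) t
      have p1 := pre p h1.le
      have p2 := pre b h2.le
      by_cases h3 : p + b ≤ (WL (k+1) t).length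
      · have p3 := pre _ h3
        have h4 := WL_len_pos k (t+1)
        refine ⟨fun h => ?_, fun h => by omega⟩
        rw [p1, p2, p3]
        exact hI.1 h3
      · have p3 := pre _ le_rfl
        have p4 := pre (p + b - (WL (k+1) t).length) (by omega)
        have h5 := hI.2 (by omega)
        have h6 := key (WL (k+1) t).length (p + b - (WL (k+1) t).length) le_rfl (by omega) (by omega)
        unfold CD at h6 ⊢
        rw [show (WL (k+1) t).length + (p + b - (WL (k+1) t).length) = p + b by omega] at h6
        refine ⟨fun h => ⟨?_, fun _ _ => ?_⟩, fun h => ?_⟩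
        · have := (h6.1 h).1
          omega
        · have := (h6.1 h).2 hN (by omega)
          omega
        · have := h6.2 h
          omega

def TL (k : ℕ) : ℕ → ℕ → List ℕ
  | 0, _ => []
  | _+1, 0 => [k+2]
  | a+1, t+1 => TL k a t ++ WL k (t+1)

theorem TL_big (k : ℕ) : ∀ a t, t < a → TL k a t = WL (k+1) t
  | 0, t, h => by omega
  | a+1, 0, _ => by simp [TL, WL]
  | a+1, t+1, h => by simp only [TL, WL]; rw [TL_big k a t (by omega)]

theorem TL_small (k : ℕ) : ∀ a s, WL (k+1) (s) ++ TL k a (s+a) = WL (k+1) (s+a)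
  | 0, s => by simp [TL]
  | a+1, s => by
    rw [← add_assoc]
    simp only [TL, WL]
    rw [← List.append_assoc, TL_small k a s]

/-- prefix sums of the concatenation dominate prefix sums of the sequence -/
theorem TL_ge (k : ℕ) : ∀ a t T, t ≤ T → ∀ d, d ≤ (TL k a t).length → d ≤ (WL k T).length →
    (a ≤ t) →
    PS (WL k T) d ≤ PS (TL k a t) d
  | 0, t, T, _, d, h, _, _ => by
    have : d = 0 := by simpa [TL] using h
    subst this; simp [PS]
  | a+1, 0, T, _, d, h, _, h' => by omega
  | a+1, t+1, T, hT, d, h, hW, h' => by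
    simp only [TL] at h ⊢
    rw [List.length_append] at h
    by_cases hd : d ≤ (TL k a t).length
    · rw [PS_app_le _ _ _ hd]
      exact TL_ge k a t T (by omega) d hd hW (by omega)
    · obtain ⟨e, rfl⟩ : ∃ e, d = (TL k a t).length + e := ⟨d - (TL k a t).length, by omega⟩
      rw [PS_app_add]
      have h1 := TL_ge k a t T (by omega) _ le_rfl (by omega) (by omega)
      have h2 := ((CD_all k T (TL k a t).length e (by omega) (by omega)).1 hW).1
      have h3 := WL_pre k hT e (by omega)
      omega

theorem TL_lt_small (k a t d : ℕ) (h : a ≤ t) (hd : 1 ≤ d) (hd1 : d ≤ (TL k a t).length)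
    (hd2 : d ≤ (TL (k+1) a t).length) :
    PS (TL k a t) d < PS (TL (k+1) a t) d := by
  obtain ⟨s, rfl⟩ : ∃ s, t = s + a := ⟨t - a, by omega⟩
  have e := TL_small k a s
  have hl : (WL (k+1) s).length + (TL k a (s+a)).length = (WL (k+1) (s+a)).length := by
    rw [← e, List.length_append]
  have h1 := PS_app_add (WL (k+1) s) (TL k a (s+a)) d
  rw [e] at h1
  have h2 := WL_pre (k+1) (show s ≤ s + a by omega) _ le_rfl
  have h3 := ((CD_all (k+1) (s+a) (WL (k+1) s).length d (by omega) (by omega)).1 (by omega)).2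
    (WL_len_pos _ _) hd
  have h4 := TL_ge (k+1) a (s+a) (s+a) le_rfl d hd2 (by omega) h
  omega

theorem WL_lt (k t d : ℕ) (hd : 1 ≤ d) (hd1 : d ≤ (WL k t).length) :
    PS (WL k t) d < PS (WL (k+1) t) d := by
  have e := TL_small k t 0
  rw [zero_add] at e
  have hl : (WL (k+1) t).length = (TL k t t).length + 1 := by
    rw [← e, List.length_append]; simp [WL, add_comm]
  have h0 := WL_len_k k t
  obtain ⟨d, rfl⟩ : ∃ e, d = e + 1 := ⟨d - 1, by omega⟩
  have h1 := PS_app_add (WL (k+1) 0) (TL k t t) d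
  rw [e] at h1
  have h2 := WL_one (k+1) 0
  have h3 : (WL (k+1) 0).length = 1 := by simp [WL]
  rw [h3, h2, add_comm 1 d] at h1
  have h4 := TL_ge k t t t le_rfl d (by omega) (by omega) le_rfl
  have h5 := ((CD_all k t d 1 (by omega) (by omega)).1 hd1).1
  have h6 := WL_one k t
  omega

theorem TL_len (k : ℕ) : ∀ a t, (TL k a t).length ≤ (TL (k+1) a t).length
  | 0, t => by simp [TL]
  | a+1, 0 => by simp [TL]
  | a+1, t+1 => by
    have := TL_len k a t
    have := WL_len_k k (t+1)
    simp only [TL, List.length_append]; omega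

theorem TL_lt (k a t d : ℕ) (hd : 1 ≤ d) (hd1 : d ≤ (TL k a t).length) :
    PS (TL k a t) d < PS (TL (k+1) a t) d := by
  rcases lt_or_ge t a with h | h
  · rw [TL_big k a t h] at hd1
    rw [TL_big k a t h, TL_big (k+1) a t h]
    exact WL_lt (k+1) t d hd hd1
  · exact TL_lt_small k a t d h hd hd1 (hd1.trans (TL_len k a t))

theorem lexLt_irrefl {n : ℕ} (u : Fin n → ℕ) : ¬ lexLt u u := by
  rintro ⟨i, _, h⟩; exact lt_irrefl _ h

theorem lexLt_asymm {n : ℕ} {u v : Fin n → ℕ} (h : lexLt u v) : ¬ lexLt v u := by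
  obtain ⟨i, h1, h2⟩ := h
  rintro ⟨j, h3, h4⟩
  rcases lt_trichotomy i j with h | h | h
  · have := h3 i h; omega
  · subst h; omega
  · have := h1 j h; omega

theorem lexSeg_zero {n : ℕ} (G : Finset (Fin n → ℕ)) : lexSeg G 0 = ∅ := by
  ext m
  simp only [lexSeg, mem_filter, Nat.le_zero, card_eq_zero, notMem_empty, iff_false, not_and]
  intro hm h
  have : m ∈ (∅ : Finset (Fin n → ℕ)) := by
    rw [← h]; exact mem_filter.2 ⟨hm, Or.inl rfl⟩
  simp at this

theorem lexSeg_list {n : ℕ} (l : List (Fin n → ℕ)) (hl : l.Pairwise (fun x y => lexLt y x)) :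
    ∀ d, lexSeg l.toFinset d = (l.take d).toFinset := by
  induction l with
  | nil => intro d; simp [lexSeg]
  | cons x l ih =>
    intro d
    rw [List.pairwise_cons] at hl
    obtain ⟨hx, hl⟩ := hl
    cases d with
    | zero => simp [lexSeg_zero]
    | succ d =>
      have hxl : x ∉ l := fun h => lexLt_irrefl _ (hx x h)
      rw [List.take_succ_cons, List.toFinset_cons, List.toFinset_cons, ← ih hl d]
      ext m
      simp only [lexSeg, mem_filter, mem_insert, List.mem_toFinset]
      constructor
      · rintro ⟨rfl | hm, h⟩
        · exact Or.inl rfl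
        · refine Or.inr ⟨hm, ?_⟩
          rw [filter_insert, if_pos (Or.inr (hx m hm)), card_insert_of_notMem (by simp [hxl])] at h
          omega
      · rintro (rfl | ⟨hm, h⟩)
        · refine ⟨Or.inl rfl, ?_⟩
          rw [filter_insert, if_pos (Or.inl rfl), filter_false_of_mem]
          · simp
          · intro v hv
            rw [List.mem_toFinset] at hv
            rintro (rfl | h)
            · exact hxl hv
            · exact lexLt_asymm h (hx v hv)
        · refine ⟨Or.inr hm, ?_⟩
          rw [filter_insert, if_pos (Or.inr (hx m hm)), card_insert_of_notMem (by simp [hxl])]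
          omega

def upX {n : ℕ} (m : Fin (n+1) → ℕ) : Fin (n+1) → ℕ := m + Pi.single 0 1

def con0 {n : ℕ} (m : Fin n → ℕ) : Fin (n+1) → ℕ := Fin.cons 0 m

theorem upX_zero {n : ℕ} (m : Fin (n+1) → ℕ) : upX m 0 = m 0 + 1 := by simp [upX]
theorem upX_succ {n : ℕ} (m : Fin (n+1) → ℕ) (i : Fin n) : upX m i.succ = m i.succ := by
  simp [upX]
theorem con0_zero {n : ℕ} (m : Fin n → ℕ) : con0 m 0 = 0 := rfl
theorem con0_succ {n : ℕ} (m : Fin n → ℕ) (i : Fin n) : con0 m i.succ = m i := by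
  simp [con0]

theorem upX_lex {n : ℕ} {u v : Fin (n+1) → ℕ} (h : lexLt u v) : lexLt (upX u) (upX v) := by
  obtain ⟨i, h1, h2⟩ := h
  exact ⟨i, fun j hj => by simp [upX, h1 j hj], by simp [upX, h2]⟩

theorem con0_lex {n : ℕ} {u v : Fin n → ℕ} (h : lexLt u v) : lexLt (con0 u) (con0 v) := by
  obtain ⟨i, h1, h2⟩ := h
  refine ⟨i.succ, fun j hj => ?_, by simpa [con0_succ] using h2⟩
  cases j using Fin.cases with
  | zero => rfl
  | succ j => rw [con0_succ, con0_succ]; exact h1 j (by simpa using hj)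

theorem con0_upX {n : ℕ} (u : Fin n → ℕ) (v : Fin (n+1) → ℕ) : lexLt (con0 u) (upX v) :=
  ⟨0, fun j hj => absurd hj (by simp), by rw [con0_zero, upX_zero]; omega⟩

def ML : (k : ℕ) → ℕ → List (Fin (k+1) → ℕ)
  | 0, t => [fun _ => t]
  | _+1, 0 => [0]
  | k+1, t+1 => (ML (k+1) t).map upX ++ (ML k (t+1)).map con0

def RL (k : ℕ) : ℕ → ℕ → List (Fin (k+2) → ℕ)
  | 0, _ => []
  | _+1, 0 => [0]
  | a+1, t+1 => (RL k a t).map upX ++ (ML k (t+1)).map con0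

theorem glue_pairwise {n : ℕ} {l : List (Fin (n+1) → ℕ)} {l' : List (Fin n → ℕ)}
    (h : l.Pairwise (fun x y => lexLt y x)) (h' : l'.Pairwise (fun x y => lexLt y x)) :
    (l.map upX ++ l'.map con0).Pairwise (fun x y => lexLt y x) := by
  rw [List.pairwise_append]
  refine ⟨List.Pairwise.map _ (fun _ _ => upX_lex) h, List.Pairwise.map _ (fun _ _ => con0_lex) h', ?_⟩
  intro x hx y hy
  obtain ⟨x, _, rfl⟩ := List.mem_map.1 hx
  obtain ⟨y, _, rfl⟩ := List.mem_map.1 hy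
  exact con0_upX _ _

theorem ML_pairwise : ∀ k t, (ML k t).Pairwise (fun x y => lexLt y x)
  | 0, t => by simp [ML]
  | k+1, 0 => by simp [ML]
  | k+1, t+1 => by
    simp only [ML]; exact glue_pairwise (ML_pairwise (k+1) t) (ML_pairwise k (t+1))

theorem RL_pairwise (k : ℕ) : ∀ a t, (RL k a t).Pairwise (fun x y => lexLt y x)
  | 0, t => by simp [RL]
  | a+1, 0 => by simp [RL]
  | a+1, t+1 => by
    simp only [RL]; exact glue_pairwise (RL_pairwise k a t) (ML_pairwise k (t+1))

theorem sum_upX {n : ℕ} (m : Fin (n+1) → ℕ) : ∑ i, upX m i = ∑ i, m i + 1 := by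
  rw [Fin.sum_univ_succ, Fin.sum_univ_succ]
  simp only [upX_zero, upX_succ]; omega

theorem sum_con0 {n : ℕ} (m : Fin n → ℕ) : ∑ i, con0 m i = ∑ i, m i := by
  rw [Fin.sum_univ_succ]
  simp only [con0_zero, con0_succ]; omega

theorem shape {n : ℕ} (m : Fin (n+1) → ℕ) : (∃ m', m = upX m') ∨ (∃ m', m = con0 m') := by
  rcases Nat.eq_zero_or_pos (m 0) with h | h
  · right
    refine ⟨fun i => m i.succ, ?_⟩
    funext i
    cases i using Fin.cases with
    | zero => rw [h]; rfl
    | succ i => rw [con0_succ]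
  · left
    refine ⟨fun i => if i = 0 then m 0 - 1 else m i, ?_⟩
    funext i
    cases i using Fin.cases with
    | zero => rw [upX_zero]; simp; omega
    | succ i => rw [upX_succ]; simp [Fin.succ_ne_zero]

theorem upX_inj {n : ℕ} : Function.Injective (upX (n := n)) := by
  intro a b h; exact add_right_cancel h

theorem con0_inj {n : ℕ} : Function.Injective (con0 (n := n)) := by
  intro a b h; exact Fin.cons_right_injective (α := fun _ => ℕ) 0 h

theorem upX_ne {n : ℕ} (u : Fin n → ℕ) (v : Fin (n+1) → ℕ) : con0 u ≠ upX v := by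
  intro h
  have := congrFun h 0
  rw [con0_zero, upX_zero] at this; omega

theorem mem_glue_up {n : ℕ} {l : List (Fin (n+1) → ℕ)} {l' : List (Fin n → ℕ)} (m) :
    upX m ∈ (l.map upX ++ l'.map con0) ↔ m ∈ l := by
  simp [upX_ne, upX_inj.eq_iff]

theorem mem_glue_con {n : ℕ} {l : List (Fin (n+1) → ℕ)} {l' : List (Fin n → ℕ)} (m) :
    con0 m ∈ (l.map upX ++ l'.map con0) ↔ m ∈ l' := by
  simp [fun v => (upX_ne m v).symm, con0_inj.eq_iff]

theorem mem_ML : ∀ k t m, m ∈ ML k t ↔ ∑ i, m i = t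
  | 0, t, m => by
    simp only [ML, List.mem_singleton, Fin.sum_univ_succ]
    simp [funext_iff, Fin.forall_fin_one]
  | k+1, 0, m => by
    simp only [ML, List.mem_singleton, funext_iff]; simp
  | k+1, t+1, m => by
    simp only [ML]
    rcases shape m with ⟨m, rfl⟩ | ⟨m, rfl⟩
    · rw [mem_glue_up, mem_ML (k+1) t, sum_upX]; omega
    · rw [mem_glue_con, mem_ML k (t+1), sum_con0]

theorem mem_RL (k : ℕ) : ∀ a t m, m ∈ RL k a t ↔ ∑ i, m i = t ∧ m 0 < a
  | 0, t, m => by simp [RL]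
  | a+1, 0, m => by
    simp only [RL, List.mem_singleton]
    constructor
    · rintro rfl; simp
    · rintro ⟨h, _⟩
      funext i
      simpa using (Finset.sum_eq_zero_iff.1 h) i (mem_univ i)
  | a+1, t+1, m => by
    simp only [RL]
    rcases shape m with ⟨m, rfl⟩ | ⟨m, rfl⟩
    · rw [mem_glue_up, mem_RL k a t, sum_upX, upX_zero, Nat.add_right_cancel_iff, Nat.add_lt_add_iff_right]
    · rw [mem_glue_con, mem_ML k (t+1), sum_con0, con0_zero]; omega

/-- admissible indices -/
def CS {n : ℕ} (m : Fin n → ℕ) : Finset (Fin n) := univ.filter (fun j => ∀ i, j < i → m i = 0)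

theorem CS_upX {n : ℕ} (m : Fin (n+1) → ℕ) : CS (upX m) = CS m := by
  ext j
  simp only [CS, mem_filter, mem_univ, true_and]
  refine forall_congr' fun i => ?_
  cases i using Fin.cases with
  | zero => simp
  | succ i => rw [upX_succ]

theorem CS_con0 {n : ℕ} (m : Fin n → ℕ) (hm : m ≠ 0) : (CS (con0 m)).card = (CS m).card := by
  have : CS (con0 m) = (CS m).map (Fin.succEmb n) := by
    ext j
    simp only [CS, mem_filter, mem_univ, true_and, mem_map, Fin.coe_succEmb]
    cases j using Fin.cases with
    | zero =>
      constructor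
      · intro h
        exact absurd (funext fun i => by simpa [con0_succ] using h i.succ (Fin.succ_pos i)) hm
      · rintro ⟨a, _, h⟩
        exact absurd h (Fin.succ_ne_zero a)
    | succ j =>
      constructor
      · intro h
        exact ⟨j, fun i hi => by simpa [con0_succ] using h i.succ (by simpa using hi), rfl⟩
      · rintro ⟨a, h, e⟩
        obtain rfl := Fin.succ_injective _ e
        intro i hi
        cases i using Fin.cases with
        | zero => rfl
        | succ i => rw [con0_succ]; exact h i (by simpa using hi)
  rw [this, card_map]

theorem CS_zero {n : ℕ} : (CS (0 : Fin n → ℕ)).card = n := by simp [CS]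

theorem glue_map {n : ℕ} {l : List (Fin (n+1) → ℕ)} {l' : List (Fin n → ℕ)} (h : ∀ m ∈ l', m ≠ 0) :
    (l.map upX ++ l'.map con0).map (fun m => (CS m).card) =
      l.map (fun m => (CS m).card) ++ l'.map (fun m => (CS m).card) := by
  rw [List.map_append, List.map_map, List.map_map]
  congr 1
  · exact List.map_congr_left fun m _ => by simp [CS_upX]
  · exact List.map_congr_left fun m hm => by simp [CS_con0 m (h m hm)]

theorem ML_ne (k t : ℕ) : ∀ m ∈ ML k (t+1), m ≠ 0 := by
  rintro m hm rfl
  rw [mem_ML] at hm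
  simp at hm

theorem ML_map : ∀ k t, (ML k t).map (fun m => (CS m).card) = WL k t
  | 0, t => by
    simp only [ML, WL, List.map_cons, List.map_nil]
    congr 1
  | k+1, 0 => by simp [ML, WL, CS_zero]
  | k+1, t+1 => by
    simp only [ML, WL]
    rw [glue_map (ML_ne k t), ML_map (k+1) t, ML_map k (t+1)]

theorem RL_map (k : ℕ) : ∀ a t, (RL k a t).map (fun m => (CS m).card) = TL k a t
  | 0, t => by simp [RL, TL]
  | a+1, 0 => by simp [RL, TL, CS_zero]
  | a+1, t+1 => by
    simp only [RL, TL]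
    rw [glue_map (ML_ne k t), RL_map k a t, ML_map k (t+1)]

theorem x1exp_eq {n : ℕ} (m : Fin (n+1) → ℕ) : x1exp m = m 0 := by
  simp [x1exp]

theorem mem_RMon (n a t : ℕ) (m : Fin (n+1) → ℕ) :
    m ∈ RMon (n+1) a t ↔ ∑ i, m i = t ∧ m 0 < a := by
  simp [RMon, degMon, x1exp_eq, Finset.Nat.mem_antidiagonalTuple]

theorem RMon_eq (k a t : ℕ) : RMon (k+2) a t = (RL k a t).toFinset := by
  ext m
  rw [mem_RMon, List.mem_toFinset, mem_RL]

theorem RL_nodup (k a t : ℕ) : (RL k a t).Nodup :=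
  (RL_pairwise k a t).imp (fun {x y} h => by
    rintro rfl; exact lexLt_irrefl _ h)

theorem RMon_card (k a t : ℕ) : (RMon (k+2) a t).card = (TL k a t).length := by
  rw [RMon_eq, List.toFinset_card_of_nodup (RL_nodup k a t), ← RL_map, List.length_map]

theorem sum_seg (k a t d : ℕ) :
    ∑ m ∈ lexSeg (RMon (k+2) a t) d, (CS m).card = PS (TL k a t) d := by
  rw [RMon_eq, lexSeg_list _ (RL_pairwise k a t),
    List.sum_toFinset _ ((RL_nodup k a t).sublist (List.take_sublist _ _)), PS, ← RL_map,
    List.map_take]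

theorem lexSeg_up {n : ℕ} (G : Finset (Fin n → ℕ)) (d : ℕ) {u v : Fin n → ℕ}
    (hu : u ∈ lexSeg G d) (hv : v ∈ G) (h : lexLt u v) : v ∈ lexSeg G d := by
  simp only [lexSeg, mem_filter] at hu ⊢
  refine ⟨hv, le_trans (card_le_card ?_) hu.2⟩
  intro w hw
  rw [mem_filter] at hw ⊢
  refine ⟨hw.1, Or.inr ?_⟩
  rcases hw.2 with rfl | h'
  · exact h
  · exact lexLt_trans h h'

/-- the pairs -/
def PR {n : ℕ} (L : Finset (Fin n → ℕ)) : Finset ((_ : Fin n → ℕ) × Fin n) := L.sigma (fun m => CS m)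

def pm {n : ℕ} (x : (_ : Fin n → ℕ) × Fin n) : Fin n → ℕ := x.1 + Pi.single x.2 1

theorem pm_inj {n : ℕ} (L : Finset (Fin n → ℕ)) : Set.InjOn pm (PR L : Set ((_ : Fin n → ℕ) × Fin n)) := by
  rintro ⟨m, j⟩ hx ⟨m', j'⟩ hy h
  simp only [PR, coe_sigma, Set.mem_sigma_iff, mem_coe, CS, mem_filter, mem_univ, true_and] at hx hy
  simp only [pm] at h
  have hjj : j = j' := by
    rcases lt_trichotomy j j' with hl | hl | hl
    · have := congrFun h j'
      simp [hx.2 j' hl, hl.ne'] at this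
    · exact hl
    · have := congrFun h j
      simp [hy.2 j hl, hl.ne'] at this
  subst hjj
  have := add_right_cancel h
  subst this
  rfl

theorem R1_eq (n a t d : ℕ) :
    R1mul (n+1) a (lexSeg (RMon (n+1) a t) d) =
      ((PR (lexSeg (RMon (n+1) a t) d)).image pm).filter (fun m => m 0 < a) := by
  ext u
  simp only [R1mul, mem_filter, S1mul, mem_biUnion, mem_univ, true_and, mem_image, x1exp_eq]
  refine and_congr_left fun hu => ?_
  constructor
  · rintro ⟨j, m, hm, rfl⟩
    have hmR : m ∈ RMon (n+1) a t := (mem_filter.1 hm).1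
    rw [mem_RMon] at hmR
    by_cases hj : j ∈ CS m
    · exact ⟨⟨m, j⟩, by simp [PR, hm, hj], rfl⟩
    -- the last nonzero index
    let Z := univ.filter (fun i => m i ≠ 0)
    have hZ : ∃ i, j < i ∧ m i ≠ 0 := by
      simpa [CS] using hj
    obtain ⟨i, hji, hi⟩ := hZ
    have hne : Z.Nonempty := ⟨i, by simp [Z, hi]⟩
    set k := Z.max' hne with hk
    have hkm : m k ≠ 0 := by
      have := Z.max'_mem hne
      simpa [Z] using this
    have hik : i ≤ k := Z.le_max' i (by simp [Z, hi])
    have hjk : j < k := lt_of_lt_of_le hji hik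
    have hz : ∀ l, k < l → m l = 0 := by
      intro l hl
      by_contra hc
      exact absurd (Z.le_max' l (by simp [Z, hc])) (not_le.2 hl)
    have hle : Pi.single k 1 ≤ m := by
      intro l
      by_cases hl : l = k
      · subst hl; simp; omega
      · simp [hl]
    obtain ⟨m0, hm0⟩ : ∃ m0, m = m0 + Pi.single k 1 := ⟨m - Pi.single k 1, by
      rw [tsub_add_cancel_of_le hle]⟩
    refine ⟨⟨m0 + Pi.single j 1, k⟩, ?_, ?_⟩
    · simp only [PR, mem_sigma]
      constructor
      · refine lexSeg_up _ _ hm ?_ ⟨j, fun l hl => ?_, ?_⟩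
        · rw [mem_RMon]
          constructor
          · rw [← hmR.1, hm0]
            simp [Finset.sum_add_distrib]
          · refine lt_of_le_of_lt ?_ hu
            rw [hm0]; simp only [Pi.add_apply]; omega
        · rw [hm0]
          simp [hl.ne, (hl.trans hjk).ne]
        · rw [hm0]
          simp [hjk.ne]
      · simp only [CS, mem_filter, mem_univ, true_and]
        intro l hl
        have := hz l hl
        rw [hm0] at this
        simp [(hjk.trans hl).ne', hl.ne'] at this ⊢
        exact this
    · simp only [pm]
      rw [hm0, add_right_comm]
  · rintro ⟨⟨m, j⟩, hx, rfl⟩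
    simp only [PR, mem_sigma] at hx
    exact ⟨j, m, hx.1, rfl⟩

theorem bad_eq (n a t d : ℕ) (hd : 1 ≤ d) :
    ((PR (lexSeg (RMon (n+1) a t) d)).image pm).filter (fun m => ¬ m 0 < a) =
      if t + 1 = a then {Pi.single 0 (t+1)} else ∅ := by
  have key : ∀ u ∈ ((PR (lexSeg (RMon (n+1) a t) d)).image pm).filter (fun m => ¬ m 0 < a),
      t + 1 = a ∧ u = Pi.single 0 (t+1) := by
    intro u hu
    rw [mem_filter, mem_image] at hu
    obtain ⟨⟨⟨m, j⟩, hx, rfl⟩, hu⟩ := hu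
    simp only [PR, mem_sigma, CS, mem_filter, mem_univ, true_and] at hx
    have hmR : m ∈ RMon (n+1) a t := (mem_filter.1 hx.1).1
    rw [mem_RMon] at hmR
    simp only [pm, Pi.add_apply] at hu ⊢
    have hj : j = 0 := by
      by_contra hj
      rw [Pi.single_eq_of_ne (Ne.symm hj)] at hu
      omega
    subst hj
    have hm : m = Pi.single 0 t := by
      have h0 : ∀ i : Fin n, m i.succ = 0 := fun i => hx.2 _ (Fin.succ_pos i)
      have hs := hmR.1
      rw [Fin.sum_univ_succ] at hs
      simp only [h0, sum_const_zero, add_zero] at hs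
      funext i
      cases i using Fin.cases with
      | zero => simp [hs]
      | succ i => simp [h0 i]
    subst hm
    simp at hu hmR
    refine ⟨by omega, by rw [← Pi.single_add]⟩
  split_ifs with h
  · ext u
    rw [mem_singleton]
    refine ⟨fun hu => (key u hu).2, ?_⟩
    rintro rfl
    rw [mem_filter, mem_image]
    refine ⟨⟨⟨Pi.single 0 t, 0⟩, ?_, ?_⟩, by simp [h]⟩
    · simp only [PR, mem_sigma, CS, mem_filter, mem_univ, true_and]
      constructor
      · simp only [lexSeg, mem_filter]
        refine ⟨by rw [mem_RMon]; simp; omega, ?_⟩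
        refine le_trans (card_le_one.2 ?_) hd
        have hh : ∀ v ∈ (RMon (n+1) a t).filter
            (fun v => Pi.single 0 t = v ∨ lexLt (Pi.single 0 t) v), Pi.single 0 t = v := by
          intro v hv
          rw [mem_filter, mem_RMon] at hv
          rcases hv.2 with hv' | ⟨i, hi1, hi2⟩
          · exact hv'
          · exfalso
            have hs := hv.1.1
            cases i using Fin.cases with
            | zero =>
              rw [Pi.single_eq_same] at hi2
              have := Finset.single_le_sum (f := v) (fun _ _ => Nat.zero_le _) (mem_univ 0)
              omega
            | succ i =>
              have h0 := hi1 0 (Fin.succ_pos i)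
              rw [Pi.single_eq_same] at h0
              rw [Fin.sum_univ_succ] at hs
              have := Finset.single_le_sum (f := fun i : Fin n => v i.succ)
                (fun _ _ => Nat.zero_le _) (mem_univ i)
              omega
        intro x hx y hy
        rw [← hh x hx, ← hh y hy]
      · intro i hi
        simp [hi.ne']
    · simp only [pm]
      rw [← Pi.single_add]
  · rw [eq_empty_iff_forall_notMem]
    exact fun u hu => h (key u hu).1

theorem dnt_eq (k a t d : ℕ) (hd : 1 ≤ d) :
    dnt (k+2) a t d + (if t + 1 = a then 1 else 0) = PS (TL k a t) d := by
  rw [← sum_seg, dnt, R1_eq (k+1) a t d]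
  have h1 := card_filter_add_card_filter_not
    (s := (PR (lexSeg (RMon (k+1+1) a t) d)).image pm) (fun m => m 0 < a)
  rw [bad_eq (k+1) a t d hd, card_image_of_injOn (pm_inj _), PR, card_sigma] at h1
  have h2 : (if t + 1 = a then ({Pi.single 0 (t+1)} : Finset (Fin (k+1+1) → ℕ)) else ∅).card =
      if t + 1 = a then 1 else 0 := by
    split_ifs <;> simp
  rw [h2] at h1
  exact h1

/-- For positive integers `d, n, t` with `n ≥ 2`, and `d` smaller than
the number of monomials of `R_t` in both `n` and `n + 1` variables,
`d_{n+1,t} > d_{n,t}`. -/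
theorem stmt_12 (n a t d : ℕ) (hn : 2 ≤ n) (ha : 1 ≤ a) (ht : 1 ≤ t) (hd0 : 1 ≤ d)
    (h1 : d < (RMon n a t).card) (h2 : d < (RMon (n + 1) a t).card) :
    dnt n a t d < dnt (n + 1) a t d := by
  obtain ⟨k, rfl⟩ : ∃ k, n = k + 2 := ⟨n - 2, by omega⟩
  have e1 := dnt_eq k a t d hd0
  have e2 := dnt_eq (k+1) a t d hd0
  rw [RMon_card] at h1
  have h := TL_lt k a t d hd0 h1.le
  have e3 : dnt (k + 1 + 2) a t d = dnt (k + 2 + 1) a t d := rfl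
  omega
end
end
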